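/- Let β > 2 and T > 0, and for s > 0 define Z(s) = s^{2/β} ∫_{s^{−2/β}}^∞ (1 + u^{β/2})^{−1} du. Let λ_1, λ_j, λ_k, λ'_1 > 0 and P_1, P_j, P_k > 0, and set κ = (P_1/P_j)^{1/β} and B = λ_j + λ_k (P_k/P_j)^{2/β}. Then ∫_0^∞ ∫_0^{κ y} 4π² λ_1 λ_j x y · exp{ −π λ_1 x² − π B y² (1 + Z(T)) − π λ'_1 x² Z( T κ^β y^β / x^β ) } dx dy = ∫_0^1 2 λ_1 λ_j κ² x / { B (1 + Z(T)) + [ λ_1 + λ'_1 Z( T x^{−β} ) ] κ² x² }² dx, where the left-hand side is an iterated integral over {(x,y) : y > 0, 0 < x < κ y}. -/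

import Mathlib

open Real MeasureTheory

/-- The normalized interference exponent `Z(s) = s^{2/β} ∫_{s^{−2/β}}^∞ (1+u^{β/2})⁻¹ du`. -/
noncomputable def Zfun (β s : ℝ) : ℝ :=
  s ^ (2 / β) * ∫ u in Set.Ioi (s ^ (-(2 / β))), (1 + u ^ (β / 2))⁻¹

lemma Zfun_nonneg (β s : ℝ) (hs : 0 ≤ s) : 0 ≤ Zfun β s := by
  unfold Zfun
  refine mul_nonneg (Real.rpow_nonneg hs _) ?_
  refine setIntegral_nonneg measurableSet_Ioi ?_
  intro u hu
  have : 0 ≤ u := le_trans (Real.rpow_nonneg hs _) (le_of_lt hu)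
  have := Real.rpow_nonneg this (β / 2)
  positivity

lemma tail_measurable (f : ℝ → ℝ) (hf : Measurable f) :
    Measurable (fun c : ℝ => ∫ u in Set.Ioi c, f u) := by
  have h : StronglyMeasurable (fun p : ℝ × ℝ => Set.indicator {p : ℝ × ℝ | p.1 < p.2} (fun p => f p.2) p) := by
    apply Measurable.stronglyMeasurable
    exact (hf.comp measurable_snd).indicator (measurableSet_lt measurable_fst measurable_snd)
  have h2 := (h.integral_prod_right' (ν := volume)).measurable
  convert h2 using 2 with c
  rw [← integral_indicator measurableSet_Ioi]
  rfl

lemma Zfun_measurable (β : ℝ) : Measurable (Zfun β) := by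
  unfold Zfun
  have := tail_measurable (fun u : ℝ => (1 + u ^ (β / 2))⁻¹) (by fun_prop)
  exact (measurable_id.pow_const _).mul (this.comp (measurable_id.pow_const _))

lemma gauss3 (b : ℝ) (hb : 0 < b) :
    ∫ y in Set.Ioi (0 : ℝ), y ^ 3 * Real.exp (-(b * y ^ 2)) = 1 / (2 * b ^ 2) := by
  have h := integral_rpow_mul_exp_neg_mul_rpow (p := 2) (q := 3) (b := b) (by norm_num) (by norm_num) hb
  norm_num at h
  have e : ∀ y : ℝ, y ^ (3 : ℝ) * Real.exp (-(b * y ^ (2 : ℝ))) = y ^ 3 * Real.exp (-(b * y ^ 2)) := by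
    intro y; norm_cast
  simp only [← Real.rpow_natCast] at *
  norm_num at *
  rw [h]

lemma gauss3_int (b : ℝ) (hb : 0 < b) :
    IntegrableOn (fun y : ℝ => y ^ 3 * Real.exp (-(b * y ^ 2))) (Set.Ioi 0) := by
  have h := integrableOn_rpow_mul_exp_neg_mul_sq hb (s := 3) (by norm_num)
  refine h.congr_fun (fun y hy => ?_) measurableSet_Ioi
  norm_num [neg_mul]

lemma scale_Ioo (f : ℝ → ℝ) (c : ℝ) (hc : 0 < c) :
    ∫ x in Set.Ioo 0 c, f x = c * ∫ x in Set.Ioo (0 : ℝ) 1, f (c * x) := by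
  rw [← integral_Ioc_eq_integral_Ioo, ← integral_Ioc_eq_integral_Ioo,
    ← intervalIntegral.integral_of_le hc.le, ← intervalIntegral.integral_of_le zero_le_one,
    intervalIntegral.mul_integral_comp_mul_left]
  simp

lemma core (A κ C : ℝ) (hA : 0 < A) (G : ℝ → ℝ) (hG : Measurable G)
    (hG0 : ∀ x ∈ Set.Ioo (0 : ℝ) 1, 0 ≤ G x) :
    ∫ y in Set.Ioi (0 : ℝ), ∫ x in Set.Ioo (0 : ℝ) 1,
      C * x * (y ^ 3 * Real.exp (-((π * (A + G x)) * y ^ 2))) =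
    ∫ x in Set.Ioo (0 : ℝ) 1, C * x * (1 / (2 * (π * (A + G x)) ^ 2)) := by
  rw [integral_integral_swap]
  · refine setIntegral_congr_fun measurableSet_Ioo (fun x hx => ?_)
    have := hG0 x hx
    rw [integral_const_mul, gauss3]
    positivity
  · have hb : Integrable (fun p : ℝ × ℝ => (p.1 ^ 3 * Real.exp (-((π * A) * p.1 ^ 2))) * |C|)
        ((volume.restrict (Set.Ioi (0 : ℝ))).prod (volume.restrict (Set.Ioo (0 : ℝ) 1))) :=
      Integrable.mul_prod (gauss3_int (π * A) (by positivity)) (integrable_const _)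
    refine hb.mono' ?_ ?_
    · apply Measurable.aestronglyMeasurable
      simp only [Function.uncurry_def]
      fun_prop
    · rw [Measure.prod_restrict]
      refine (ae_restrict_mem (measurableSet_Ioi.prod measurableSet_Ioo)).mono ?_
      rintro ⟨y, x⟩ ⟨hy, hx⟩
      have hg := hG0 x hx
      have hy' : 0 < y := hy
      have hx0 : 0 < x := hx.1
      have hx1 : x < 1 := hx.2
      simp only [Function.uncurry_def, Real.norm_eq_abs, abs_mul, Real.abs_exp, abs_pow,
        abs_of_pos hy', abs_of_pos hx0]
      rw [mul_comm]
      have h1 : Real.exp (-((π * (A + G x)) * y ^ 2)) ≤ Real.exp (-((π * A) * y ^ 2)) := by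
        apply Real.exp_le_exp.2
        have : 0 ≤ π * G x * y ^ 2 := by positivity
        nlinarith
      have h2 : |C| * x ≤ |C| := mul_le_of_le_one_right (abs_nonneg _) hx1.le
      gcongr

/-- Equation (44), the computational core of Theorems 3 and 6 (Case 3): the iterated
integral over `{(x,y) : y > 0, 0 < x < κy}` of the Case-3 joint density times the
interference Laplace functionals reduces, via `x = κyx'` and Gaussian integration
over `y`, to a one-dimensional integral over `(0,1)`. -/
theorem case3_integral_reduction (β T lam1 lamj lamk lam1' P1 Pj Pk : ℝ)
    (hβ : 2 < β) (hT : 0 < T)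
    (h1 : 0 < lam1) (hj : 0 < lamj) (hk : 0 < lamk) (h1' : 0 < lam1')
    (hP1 : 0 < P1) (hPj : 0 < Pj) (hPk : 0 < Pk) :
    (∫ y in Set.Ioi (0 : ℝ), ∫ x in Set.Ioo 0 ((P1 / Pj) ^ (1 / β) * y),
      4 * π ^ 2 * lam1 * lamj * x * y *
        Real.exp (-(π * lam1 * x ^ 2)
          - π * (lamj + lamk * (Pk / Pj) ^ (2 / β)) * y ^ 2 * (1 + Zfun β T)
          - π * lam1' * x ^ 2 *
              Zfun β (T * ((P1 / Pj) ^ (1 / β)) ^ β * y ^ β / x ^ β))) =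
    ∫ x in Set.Ioo (0 : ℝ) 1,
      2 * lam1 * lamj * ((P1 / Pj) ^ (1 / β)) ^ 2 * x /
        ((lamj + lamk * (Pk / Pj) ^ (2 / β)) * (1 + Zfun β T) +
          (lam1 + lam1' * Zfun β (T * x ^ (-β))) *
            ((P1 / Pj) ^ (1 / β)) ^ 2 * x ^ 2) ^ 2 := by
  have hκ : 0 < (P1 / Pj) ^ (1 / β) := by positivity
  have hB : 0 < lamj + lamk * (Pk / Pj) ^ (2 / β) := by positivity
  have hZ : 0 ≤ Zfun β T := Zfun_nonneg β T hT.le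
  generalize (P1 / Pj) ^ (1 / β) = κ at *
  generalize lamj + lamk * (Pk / Pj) ^ (2 / β) = B at *
  have hA : 0 < B * (1 + Zfun β T) := by positivity
  have hZm := Zfun_measurable β
  have hGm : Measurable (fun x : ℝ => (lam1 + lam1' * Zfun β (T * x ^ (-β))) * κ ^ 2 * x ^ 2) := by
    have : Measurable (fun x : ℝ => Zfun β (T * x ^ (-β))) :=
      hZm.comp (by fun_prop)
    fun_prop
  have hG0 : ∀ x ∈ Set.Ioo (0 : ℝ) 1,
      0 ≤ (lam1 + lam1' * Zfun β (T * x ^ (-β))) * κ ^ 2 * x ^ 2 := by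
    intro x hx
    have := Zfun_nonneg β (T * x ^ (-β)) (mul_nonneg hT.le (Real.rpow_nonneg hx.1.le _))
    positivity
  have key := core (B * (1 + Zfun β T)) κ (4 * π ^ 2 * lam1 * lamj * κ ^ 2) hA _ hGm hG0
  refine Eq.trans ?_ (key.trans ?_)
  · refine setIntegral_congr_fun measurableSet_Ioi (fun y hy => ?_)
    have hy' : 0 < y := hy
    rw [scale_Ioo _ _ (mul_pos hκ hy'), ← integral_const_mul]
    refine setIntegral_congr_fun measurableSet_Ioo (fun x hx => ?_)
    have hx0 : 0 < x := hx.1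
    have e : T * κ ^ β * y ^ β / (κ * y * x) ^ β = T * x ^ (-β) := by
      rw [Real.mul_rpow (by positivity) hx0.le, Real.mul_rpow hκ.le hy'.le, Real.rpow_neg hx0.le]
      have := Real.rpow_pos_of_pos hκ β
      have := Real.rpow_pos_of_pos hy' β
      have := Real.rpow_pos_of_pos hx0 β
      field_simp
    simp only [e]
    have e2 : ∀ a b : ℝ, a = b → Real.exp a = Real.exp b := fun a b h => by rw [h]
    rw [e2 _ (-((π * (B * (1 + Zfun β T) + (lam1 + lam1' * Zfun β (T * x ^ (-β))) * κ ^ 2 * x ^ 2)) * y ^ 2)) (by ring)]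
    ring
  · refine setIntegral_congr_fun measurableSet_Ioo (fun x hx => ?_)
    have := hG0 x hx
    have hD : 0 < B * (1 + Zfun β T) + (lam1 + lam1' * Zfun β (T * x ^ (-β))) * κ ^ 2 * x ^ 2 := by
      positivity
    generalize B * (1 + Zfun β T) + (lam1 + lam1' * Zfun β (T * x ^ (-β))) * κ ^ 2 * x ^ 2 = D at *
    field_simp
    ring
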